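/- There exists a constant C₄ > 0 such that for all ỹ, μ̃ ∈ ℝ and all σ > 0, |ỹ|·f₁((ỹ - μ̃)/σ) ≤ |ỹ|·f₁((|ỹ| - |μ̃|)/σ) ≤ C₄·(σ + |μ̃|). -/

import Mathlib

open MeasureTheory Real Filter Set

/-- Normal density with mean `0` and variance `u`. -/
noncomputable def normPdf (z u : ℝ) : ℝ :=
  (Real.sqrt (2 * Real.pi * u))⁻¹ * Real.exp (-(z ^ 2) / (2 * u))

/-- Density of the `H`-distribution with parameter `γ`. -/
noncomputable def Hdens (γ u : ℝ) : ℝ :=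
  γ / ((1 + u) * (1 + Real.log (1 + u)) ^ (1 + γ))

/-- `f₁(z) = ∫₀^∞ φ(z;0,u) H(u;γ) du`, the scale mixture of normals by the
`H`-distribution. -/
noncomputable def f1 (γ z : ℝ) : ℝ :=
  ∫ u in Set.Ioi (0:ℝ), normPdf z u * Hdens γ u

theorem normPdf_nonneg (z u : ℝ) : 0 ≤ normPdf z u := by
  unfold normPdf; positivity

theorem normPdf_le_of_abs_le {z w u : ℝ} (hu : 0 < u) (h : |w| ≤ |z|) :
    normPdf z u ≤ normPdf w u := by
  unfold normPdf
  have := sq_le_sq.mpr h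
  gcongr

theorem abs_mul_normPdf_le_one (z : ℝ) {u : ℝ} (hu : 0 < u) : |z| * normPdf z u ≤ 1 := by
  unfold normPdf
  have hs : 0 < √(2 * π * u) := by positivity
  set x := |z| * (√(2 * π * u))⁻¹ with hx
  have hxsq : x ^ 2 ≤ z ^ 2 / (2 * u) := by
    rw [hx, mul_pow, inv_pow, Real.sq_sqrt (by positivity), sq_abs, ← div_eq_mul_inv]
    gcongr
    nlinarith [Real.pi_gt_three]
  rw [← mul_assoc, neg_div, Real.exp_neg, ← div_eq_mul_inv, div_le_one (Real.exp_pos _)]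
  have := Real.add_one_le_exp (z ^ 2 / (2 * u))
  nlinarith [sq_nonneg (x - 1), sq_nonneg x]

theorem Hdens_nonneg {γ u : ℝ} (hγ : 0 < γ) (hu : 0 < u) : 0 ≤ Hdens γ u := by
  have := Real.log_nonneg (by linarith : 1 ≤ 1 + u)
  unfold Hdens
  positivity

theorem Hdens_le {γ u : ℝ} (hγ : 0 < γ) (hu : 0 < u) : Hdens γ u ≤ γ := by
  have hl := Real.log_nonneg (by linarith : 1 ≤ 1 + u)
  unfold Hdens
  apply div_le_self hγ.le
  have : 1 ≤ (1 + Real.log (1 + u)) ^ (1 + γ) := Real.one_le_rpow (by linarith) (by linarith)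
  nlinarith

theorem integrableOn_Hdens {γ : ℝ} (hγ : 0 < γ) : IntegrableOn (Hdens γ) (Ioi 0) := by
  have hd : ∀ u ∈ Ici (0 : ℝ),
      HasDerivAt (fun u ↦ -(1 + Real.log (1 + u)) ^ (-γ)) (Hdens γ u) u := by
    intro u hu
    have hu : 0 ≤ u := hu
    have hl := Real.log_nonneg (by linarith : 1 ≤ 1 + u)
    have hp : 0 < 1 + Real.log (1 + u) := by linarith
    have h1 : HasDerivAt (fun u : ℝ ↦ 1 + Real.log (1 + u)) (1 / (1 + u)) u :=
      (((hasDerivAt_id u).const_add 1).log (by simp; linarith)).const_add 1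
    refine (h1.rpow_const (p := -γ) (Or.inl hp.ne')).fun_neg.congr_deriv ?_
    have he : -γ - 1 = -(1 + γ) := by ring
    rw [Hdens, he, Real.rpow_neg hp.le]
    field_simp
  refine integrableOn_Ioi_deriv_of_nonneg' hd (fun u hu ↦ Hdens_nonneg hγ hu) (l := -0) ?_
  refine Tendsto.neg ((tendsto_rpow_neg_atTop hγ).comp ?_)
  exact tendsto_atTop_add_const_left _ _
    (Real.tendsto_log_atTop.comp (tendsto_atTop_add_const_left _ _ tendsto_id))

theorem measurable_normPdf_mul_Hdens (γ z : ℝ) :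
    Measurable fun u ↦ normPdf z u * Hdens γ u := by
  unfold normPdf Hdens
  fun_prop

theorem normPdf_le_rpow (z : ℝ) {u : ℝ} (hu : 0 < u) : normPdf z u ≤ u ^ (-(1 / 2) : ℝ) := by
  have h : √u ≤ √(2 * π * u) := Real.sqrt_le_sqrt (by nlinarith [Real.pi_gt_three])
  rw [Real.rpow_neg hu.le, ← Real.sqrt_eq_rpow, normPdf]
  have he : Real.exp (-(z ^ 2) / (2 * u)) ≤ 1 := by
    rw [Real.exp_le_one_iff, neg_div]
    have : 0 ≤ z ^ 2 / (2 * u) := by positivity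
    linarith
  have hs := Real.sqrt_pos.mpr hu
  calc (√(2 * π * u))⁻¹ * Real.exp (-(z ^ 2) / (2 * u)) ≤ (√(2 * π * u))⁻¹ * 1 := by gcongr
    _ ≤ (√u)⁻¹ := by rw [mul_one]; gcongr

theorem integrableOn_normPdf_mul_Hdens {γ : ℝ} (hγ : 0 < γ) (z : ℝ) :
    IntegrableOn (fun u ↦ normPdf z u * Hdens γ u) (Ioi 0) := by
  rw [← Ioc_union_Ioi_eq_Ioi zero_le_one, integrableOn_union]
  have hm := (measurable_normPdf_mul_Hdens γ z).aestronglyMeasurable (μ := volume)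
  constructor
  · have hi : IntegrableOn (fun u : ℝ ↦ u ^ (-(1 / 2) : ℝ) * γ) (Ioc 0 1) :=
      ((intervalIntegrable_iff_integrableOn_Ioc_of_le zero_le_one).mp
        (intervalIntegral.intervalIntegrable_rpow' (by norm_num))).mul_const γ
    refine hi.mono' hm.restrict (ae_restrict_of_forall_mem measurableSet_Ioc fun u hu ↦ ?_)
    have hn := normPdf_nonneg z u
    have hH := Hdens_nonneg hγ hu.1
    rw [Real.norm_of_nonneg (mul_nonneg hn hH)]
    exact mul_le_mul (normPdf_le_rpow z hu.1) (Hdens_le hγ hu.1) hH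
      (hn.trans (normPdf_le_rpow z hu.1))
  · refine ((integrableOn_Hdens hγ).mono_set (Ioi_subset_Ioi zero_le_one)).mono' hm.restrict
      (ae_restrict_of_forall_mem measurableSet_Ioi fun u (hu : 1 < u) ↦ ?_)
    have hu0 : 0 < u := by linarith
    have hH := Hdens_nonneg hγ hu0
    rw [Real.norm_of_nonneg (mul_nonneg (normPdf_nonneg z u) hH)]
    exact mul_le_of_le_one_left hH ((normPdf_le_rpow z hu0).trans
      (Real.rpow_le_one_of_one_le_of_nonpos hu.le (by norm_num)))

theorem f1_nonneg {γ : ℝ} (hγ : 0 < γ) (z : ℝ) : 0 ≤ f1 γ z :=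
  setIntegral_nonneg measurableSet_Ioi fun _ hu ↦
    mul_nonneg (normPdf_nonneg _ _) (Hdens_nonneg hγ hu)

theorem f1_le_of_abs_le {γ : ℝ} (hγ : 0 < γ) {z w : ℝ} (h : |w| ≤ |z|) : f1 γ z ≤ f1 γ w :=
  setIntegral_mono_on (integrableOn_normPdf_mul_Hdens hγ z) (integrableOn_normPdf_mul_Hdens hγ w)
    measurableSet_Ioi fun _ hu ↦
      mul_le_mul_of_nonneg_right (normPdf_le_of_abs_le hu h) (Hdens_nonneg hγ hu)

theorem abs_mul_f1_le {γ : ℝ} (hγ : 0 < γ) (z : ℝ) :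
    |z| * f1 γ z ≤ ∫ u in Ioi (0 : ℝ), Hdens γ u := by
  rw [f1, ← integral_const_mul]
  refine setIntegral_mono_on ((integrableOn_normPdf_mul_Hdens hγ z).const_mul _)
    (integrableOn_Hdens hγ) measurableSet_Ioi fun u hu ↦ ?_
  rw [← mul_assoc]
  exact mul_le_of_le_one_left (Hdens_nonneg hγ hu) (abs_mul_normPdf_le_one z hu)

/-- There is `C₄ > 0` such that for all `ỹ, μ̃ ∈ ℝ` and `σ > 0`,
`|ỹ| f₁((ỹ-μ̃)/σ) ≤ |ỹ| f₁((|ỹ|-|μ̃|)/σ) ≤ C₄ (σ + |μ̃|)`. -/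
theorem f1_scaled_bound (γ : ℝ) (hγ : 0 < γ) :
    ∃ C₄ > (0:ℝ), ∀ y μ σ : ℝ, 0 < σ →
      |y| * f1 γ ((y - μ) / σ) ≤ |y| * f1 γ ((|y| - |μ|) / σ) ∧
        |y| * f1 γ ((|y| - |μ|) / σ) ≤ C₄ * (σ + |μ|) := by
  have hI : 0 ≤ ∫ u in Ioi (0 : ℝ), Hdens γ u :=
    setIntegral_nonneg measurableSet_Ioi fun _ hu ↦ Hdens_nonneg hγ hu
  have h0 := f1_nonneg hγ 0
  refine ⟨(∫ u in Ioi (0 : ℝ), Hdens γ u) + f1 γ 0 + 1, by linarith, fun y μ σ hσ ↦ ⟨?_, ?_⟩⟩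
  · refine mul_le_mul_of_nonneg_left (f1_le_of_abs_le hγ ?_) (abs_nonneg y)
    rw [abs_div, abs_div]
    exact div_le_div_of_nonneg_right (abs_abs_sub_abs_le y μ) (abs_nonneg σ)
  · set z := (|y| - |μ|) / σ with hz
    have hy : |y| ≤ σ * |z| + |μ| := by
      have : |y| = σ * z + |μ| := by rw [hz]; field_simp; ring
      rw [this]
      gcongr
      exact le_abs_self z
    have hz0 : f1 γ z ≤ f1 γ 0 := f1_le_of_abs_le hγ (by simp)
    have hμ := abs_nonneg μ
    calc |y| * f1 γ z ≤ (σ * |z| + |μ|) * f1 γ z :=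
          mul_le_mul_of_nonneg_right hy (f1_nonneg hγ z)
      _ = σ * (|z| * f1 γ z) + |μ| * f1 γ z := by ring
      _ ≤ σ * (∫ u in Ioi (0 : ℝ), Hdens γ u) + |μ| * f1 γ 0 := by
          gcongr
          exact abs_mul_f1_le hγ z
      _ ≤ _ := by nlinarith [mul_nonneg hσ.le h0, mul_nonneg hμ hI]
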